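/- Let A = M = k[X], f(X) ∈ k[X], B = k[f] the subalgebra generated by f, ε : B → A the inclusion. For q(X) ∈ k[X] define σ_q : A ⊗ A ⊗ B → A by σ_q(P ⊗ Q ⊗ α(f)) = q(X)P(X)Q(X)α'(f(X)). Then σ_q is a secondary Hochschild 2-cocycle; every class in H^2((A,B,ε);A) equals the class of some σ_q; and the classes of σ_p and σ_q coincide if and only if p(X) ≡ q(X) modulo the ideal generated by f'(X). In particular, if char k does not divide n ≥ 2 and f(X) = X^n, then dim_k H^2((k[X], k[X^n], ε); k[X]) = n − 1. -/

import Mathlib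

open Finset MulOpposite

namespace SecondaryHochschild

variable {k : Type*} [CommRing k] {A : Type*} [Ring A] [Algebra k A]
  {B : Type*} [CommRing B] [Algebra k B]

/-- Secondary Hochschild cochains with coefficients in `A`.  A cochain of degree `n`
is modelled as a function of the diagonal entries `a 0, …, a (n-1)` and the upper
entries `b i j` (for `i < j < n`) of the triangular tensor matrix. -/
abbrev Cochain (A B : Type*) : Type _ := (ℕ → A) → (ℕ → ℕ → B) → A

/-- Reindexing map merging positions `i` and `i+1`. -/
def mIdx (i j : ℕ) : ℕ := if j ≤ i then j else j + 1

/-- Diagonal of the `i`-th inner face `M^{1,n}_{i,i+1}` of the tensor matrix `(a, b)`. -/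
def faceA (ε : B →ₐ[k] A) (i : ℕ) (a : ℕ → A) (b : ℕ → ℕ → B) : ℕ → A :=
  fun j => if j = i then ε (b i (i+1)) * a i * a (i+1) else a (mIdx i j)

/-- Upper entries of the `i`-th inner face `M^{1,n}_{i,i+1}`. -/
def faceB (i : ℕ) (b : ℕ → ℕ → B) : ℕ → ℕ → B :=
  fun j l =>
    if j = i then b i (mIdx i l) * b (i+1) (mIdx i l)
    else if l = i then b (mIdx i j) i * b (mIdx i j) (i+1)
    else b (mIdx i j) (mIdx i l)

/-- The secondary Hochschild differential `δ^ε_n : C^n((A,B,ε);A) → C^{n+1}((A,B,ε);A)`. -/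
def δ (ε : B →ₐ[k] A) (n : ℕ) (f : Cochain A B) : Cochain A B :=
  fun a b =>
    a 0 * ε (∏ j ∈ Finset.range n, b 0 (j+1)) *
        f (fun j => a (j+1)) (fun j l => b (j+1) (l+1))
      + ∑ i ∈ Finset.range n, (-1 : ℤ)^(i+1) • f (faceA ε i a b) (faceB i b)
      + (-1 : ℤ)^(n+1) • (f a b * (a n * ε (∏ j ∈ Finset.range n, b j n)))

/-- The cup product of an `m`-cochain `f` and an `n`-cochain `g`:
`(f ⌣ g)(T^0_{m+n}) = f(T^0_m) g(T^m_{m+n}) ∏_{1≤i≤m, m+1≤j≤m+n} ε(b_{i,j})`. -/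
def cup (ε : B →ₐ[k] A) (m n : ℕ) (f g : Cochain A B) : Cochain A B :=
  fun a b =>
    f a b * g (fun j => a (m + j)) (fun j l => b (m + j) (m + l)) *
      ε (∏ i ∈ Finset.range m, ∏ j ∈ Finset.range n, b i (m + j))

/-- Reindexing map for the insertion of a block of length `n` at position `i`. -/
def insIdx (i n j : ℕ) : ℕ := if j ≤ i then j else j + n - 1

/-- The insertion operation `f ∘_i g`, inserting the value of the `n`-cochain `g` on the
`n × n` sub-block starting at position `i` into the `i`-th slot of `f`, merging the
rows and columns of `b`'s accordingly. -/
def circi (i n : ℕ) (f g : Cochain A B) : Cochain A B :=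
  fun a b =>
    f (fun j => if j = i then g (fun l => a (i + l)) (fun l l' => b (i + l) (i + l'))
                else a (insIdx i n j))
      (fun j l =>
        if j = i then ∏ t ∈ Finset.range n, b (i + t) (insIdx i n l)
        else if l = i then ∏ t ∈ Finset.range n, b (insIdx i n j) (i + t)
        else b (insIdx i n j) (insIdx i n l))

/-- The pre-Lie composition `f^m ∘ g^n = ∑_{i=0}^{m-1} (-1)^{(n-1)i} f ∘_i g`
(the sign is written `(-1)^{(n+1)i}`, which has the same parity). -/
def scomp (m n : ℕ) (f g : Cochain A B) : Cochain A B :=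
  fun a b => ∑ i ∈ Finset.range m, (-1 : ℤ)^((n+1)*i) • circi i n f g a b

/-- The Gerstenhaber bracket `[f^m, g^n] = f ∘ g - (-1)^{(m-1)(n-1)} g ∘ f`
(the sign is written `(-1)^{(m+1)(n+1)}`, which has the same parity). -/
def bracket (m n : ℕ) (f g : Cochain A B) : Cochain A B :=
  scomp m n f g - ((-1 : ℤ)^((m+1)*(n+1))) • scomp n m g f

section helpers
open Polynomial

theorem delta_two {k : Type*} [Field k] {f : k[X]}
    (F : k[X] → k[X] → ↥(Algebra.adjoin k {f}) → k[X]) (a : ℕ → k[X])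
    (b : ℕ → ℕ → ↥(Algebra.adjoin k {f})) :
    δ (Algebra.adjoin k {f}).val 2 (fun a b => F (a 0) (a 1) (b 0 1)) a b
    = a 0 * ((b 0 1 : k[X]) * b 0 2) * F (a 1) (a 2) (b 1 2)
      - F (b 0 1 * a 0 * a 1) (a 2) (b 0 2 * b 1 2)
      + F (a 0) (b 1 2 * a 1 * a 2) (b 0 1 * b 0 2)
      - F (a 0) (a 1) (b 0 1) * (a 2 * ((b 0 2 : k[X]) * b 1 2)) := by
  simp [δ, faceA, faceB, mIdx, Finset.prod_range_succ, Finset.sum_range_succ]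
  ring

theorem delta_one {k : Type*} [Field k] {f : k[X]}
    (w : k[X] → k[X]) (a : ℕ → k[X])
    (b : ℕ → ℕ → ↥(Algebra.adjoin k {f})) :
    δ (Algebra.adjoin k {f}).val 1 (fun a _ => w (a 0)) a b
    = a 0 * (b 0 1 : k[X]) * w (a 1) - w (b 0 1 * a 0 * a 1)
      + w (a 0) * (a 1 * (b 0 1 : k[X])) := by
  simp [δ, faceA, sub_eq_add_neg]

/-- the cocycle identity, in coordinates -/
theorem cocycle_coord {k : Type*} [Field k] {f : k[X]}
    (F : k[X] → k[X] → ↥(Algebra.adjoin k {f}) → k[X])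
    (h : δ (Algebra.adjoin k {f}).val 2 (fun a b => F (a 0) (a 1) (b 0 1)) = 0)
    (a0 a1 a2 : k[X]) (x y z : ↥(Algebra.adjoin k {f})) :
    a0 * ((x : k[X]) * y) * F a1 a2 z
      - F (x * a0 * a1) a2 (y * z)
      + F a0 (z * a1 * a2) (x * y)
      - F a0 a1 x * (a2 * ((y : k[X]) * z)) = 0 := by
  have := congrFun (congrFun h (fun i => if i = 0 then a0 else if i = 1 then a1 else a2))
    (fun i j => if i = 1 then z else if j = 1 then x else y)
  rw [delta_two] at this
  simpa using this

theorem exists_der {k : Type*} [Field k] (f : k[X]) (hf : f.natDegree ≠ 0) (q : k[X]) :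
    ∃ v : ↥(Algebra.adjoin k {f}) →ₗ[k] k[X],
        (∀ x y : ↥(Algebra.adjoin k {f}),
            v (x * y) = (x : k[X]) * v y + (y : k[X]) * v x)
        ∧ v ⟨f, Algebra.subset_adjoin (Set.mem_singleton_iff.mpr rfl)⟩ = q := by
  set F : ↥(Algebra.adjoin k {f}) :=
    ⟨f, Algebra.subset_adjoin (Set.mem_singleton_iff.mpr rfl)⟩ with hF
  have hval : ∀ p : k[X], ((aeval F p : ↥(Algebra.adjoin k {f})) : k[X]) = p.comp f := by
    intro p
    have := (aeval_algHom_apply (Algebra.adjoin k {f}).val F p).symm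
    rw [Subalgebra.coe_val] at this
    rw [this]
    rfl
  have hbij : Function.Bijective (aeval F : k[X] →ₐ[k] ↥(Algebra.adjoin k {f})) := by
    constructor
    · rw [injective_iff_map_eq_zero]
      intro p hp
      have h1 := hval p
      rw [hp] at h1
      have h2 : p.comp f = 0 := by simpa using h1.symm
      rcases comp_eq_zero_iff.mp h2 with h3 | h3
      · exact h3
      · exact absurd (by rw [h3.2]; simp) hf
    · intro x
      have hx := x.2
      obtain ⟨p, hp⟩ := (Algebra.adjoin_singleton_eq_range_aeval k f).le hx
      refine ⟨p, Subtype.ext ?_⟩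
      rw [hval, ← hp]
      simp [comp, aeval_def]
  let e := AlgEquiv.ofBijective _ hbij
  have he : ∀ x, ((e.symm x).comp f) = x := by
    intro x
    rw [← hval]
    exact congrArg Subtype.val (e.apply_symm_apply x)
  let v : ↥(Algebra.adjoin k {f}) →ₗ[k] k[X] :=
    (LinearMap.mulLeft k q) ∘ₗ (aeval f : k[X] →ₐ[k] k[X]).toLinearMap ∘ₗ derivative ∘ₗ
      e.symm.toLinearMap
  have hv : ∀ x, v x = q * (derivative (e.symm x)).comp f := by
    intro x
    simp [v, comp, aeval_def]
  refine ⟨v, ?_, ?_⟩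
  · intro x y
    rw [hv, hv, hv, map_mul, derivative_mul, add_comp, mul_comp, mul_comp, he, he]
    ring
  · have : e.symm F = X := by
      rw [AlgEquiv.symm_apply_eq]
      simp [e]
    rw [hv, this]
    simp

/-- Vanishing of `H^2(k[X], k[X])`. -/
theorem hochschild_vanish {k : Type*} [Field k] (s : k[X] →ₗ[k] k[X] →ₗ[k] k[X])
    (hs : ∀ a b c, a * s b c - s (a * b) c + s a (b * c) - s a b * c = 0) :
    ∃ w : k[X] →ₗ[k] k[X], ∀ a b, s a b = a * w b - w (a * b) + w a * b := by
  let c : ℕ → k[X] := fun n => Nat.rec (s 1 1)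
    (fun m r => if m = 0 then 0 else X * r - s X (X ^ m)) n
  have c0 : c 0 = s 1 1 := rfl
  have c1 : c 1 = 0 := rfl
  have cs : ∀ m, m ≠ 0 → c (m+1) = X * c m - s X (X ^ m) := by
    intro m hm
    show (if m = 0 then 0 else X * c m - s X (X ^ m)) = _
    rw [if_neg hm]
  let w : k[X] →ₗ[k] k[X] := (basisMonomials k).constr k c
  have hw : ∀ n, w (X ^ n) = c n := by
    intro n
    have := (basisMonomials k).constr_basis k c n
    rw [coe_basisMonomials] at this
    simpa only [monomial_one_right_eq_X_pow] using this
  have hs1 : ∀ b, s 1 b = s 1 1 * b := by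
    intro b
    have := hs 1 1 b
    simp only [one_mul] at this
    linear_combination this
  have hs1' : ∀ b, s b 1 = b * s 1 1 := by
    intro b
    have := hs b 1 1
    simp only [mul_one] at this
    linear_combination -this
  have hw1 : w 1 = s 1 1 := by simpa [c0] using hw 0
  have hwX : w X = 0 := by simpa [c1] using hw 1
  have hX : ∀ b, s X b = X * w b - w (X * b) := by
    intro b
    induction b using Polynomial.induction_on' with
    | add p q hp hq => simp only [mul_add, map_add, hp, hq]; ring
    | monomial n r =>
      rw [← C_mul_X_pow_eq_monomial, ← smul_eq_C_mul, mul_smul_comm, map_smul, map_smul, map_smul,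
        mul_smul_comm, ← smul_sub]
      congr 1
      rcases Nat.eq_zero_or_pos n with rfl | hn
      · rw [pow_zero, mul_one, hs1', hw1, hwX, sub_zero]
      · rw [← pow_succ', hw, hw, cs n (by omega)]
        ring
  refine ⟨w, fun a b => ?_⟩
  induction a using Polynomial.induction_on' with
  | add p q hp hq => simp only [add_mul, map_add, LinearMap.add_apply, hp, hq]; ring
  | monomial n r =>
    rw [← C_mul_X_pow_eq_monomial, ← smul_eq_C_mul, smul_mul_assoc, smul_mul_assoc, map_smul,
      map_smul, map_smul, LinearMap.smul_apply, smul_mul_assoc, ← smul_sub, ← smul_add]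
    congr 1
    induction n with
    | zero => rw [pow_zero, one_mul, one_mul, hs1, hw1]; ring
    | succ n ih =>
      have h1 := hs X (X ^ n) b
      have h2 := hX (X ^ n * b)
      have h3 := hX (X ^ n)
      rw [ih, h2, h3] at h1
      rw [pow_succ', mul_assoc X (X ^ n) b]
      linear_combination -h1

theorem der_eq {k : Type*} [Field k] (w : k[X] →ₗ[k] k[X])
    (h : ∀ a b, w (a * b) = a * w b + w a * b) (g : k[X]) : w g = derivative g * w X := by
  have h1 : w 1 = 0 := by
    have := h 1 1
    simp only [one_mul, mul_one] at this
    linear_combination -this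
  induction g using Polynomial.induction_on with
  | C r =>
    rw [show C r = r • (1 : k[X]) by rw [smul_eq_C_mul, mul_one], map_smul, h1]; simp
  | add p q hp hq => simp only [map_add, hp, hq]; ring
  | monomial n r ih =>
    rw [pow_succ, ← mul_assoc, h, ih, derivative_mul (f := C r * X ^ n), derivative_X]; ring

end helpers

/-- Let `A = M = k[X]`, `f ∈ k[X]` (nonconstant), `B = k[f]` and
`ε : B → A` the inclusion.  For `q ∈ k[X]` let `σ_q(P ⊗ Q ⊗ α(f)) = q P Q α'(f)`;
equivalently, `σ_q(P ⊗ Q ⊗ α) = P Q v(α)` where `v : B → k[X]` is the `k`-derivation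
with `v(f) = q`.  Then `σ_q` is a secondary Hochschild 2-cocycle, every class in
`H²((A,B,ε);A)` is the class of some `σ_q`, and the classes of `σ_p` and `σ_q`
coincide iff `p ≡ q (mod f')`.  In particular, for `f = Xⁿ` with `n ≥ 2` not
divisible by `char k`, `dim_k H²((k[X], k[Xⁿ], ε); k[X]) = n − 1`. -/
theorem polynomial_example
    {k : Type*} [Field k] (f : Polynomial k) (hf : f.natDegree ≠ 0) :
    -- `σ_q` exists for every `q` and is a 2-cocycle
    (∀ q : Polynomial k,
      ∃ v : ↥(Algebra.adjoin k {f}) →ₗ[k] Polynomial k,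
        (∀ x y : ↥(Algebra.adjoin k {f}),
            v (x * y) = (x : Polynomial k) * v y + (y : Polynomial k) * v x)
        ∧ v ⟨f, Algebra.subset_adjoin (Set.mem_singleton_iff.mpr rfl)⟩ = q
        ∧ δ (Algebra.adjoin k {f}).val 2 (fun a b => a 0 * a 1 * v (b 0 1)) = 0)
    -- every class in `H²` is the class of some `σ_q`
    ∧ (∀ σ : Polynomial k →ₗ[k] Polynomial k →ₗ[k]
            ↥(Algebra.adjoin k {f}) →ₗ[k] Polynomial k,
        δ (Algebra.adjoin k {f}).val 2 (fun a b => σ (a 0) (a 1) (b 0 1)) = 0 →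
        ∃ (q : Polynomial k) (v : ↥(Algebra.adjoin k {f}) →ₗ[k] Polynomial k),
          (∀ x y : ↥(Algebra.adjoin k {f}),
              v (x * y) = (x : Polynomial k) * v y + (y : Polynomial k) * v x)
          ∧ v ⟨f, Algebra.subset_adjoin (Set.mem_singleton_iff.mpr rfl)⟩ = q
          ∧ ∃ w : Polynomial k →ₗ[k] Polynomial k,
              (fun a b => σ (a 0) (a 1) (b 0 1) - a 0 * a 1 * v (b 0 1))
                = δ (Algebra.adjoin k {f}).val 1 (fun a _ => w (a 0)))
    -- `σ_p` and `σ_q` are cohomologous iff `f' ∣ p − q`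
    ∧ (∀ (p q : Polynomial k)
        (v v' : ↥(Algebra.adjoin k {f}) →ₗ[k] Polynomial k),
        (∀ x y : ↥(Algebra.adjoin k {f}),
            v (x * y) = (x : Polynomial k) * v y + (y : Polynomial k) * v x) →
        (∀ x y : ↥(Algebra.adjoin k {f}),
            v' (x * y) = (x : Polynomial k) * v' y + (y : Polynomial k) * v' x) →
        v ⟨f, Algebra.subset_adjoin (Set.mem_singleton_iff.mpr rfl)⟩ = p →
        v' ⟨f, Algebra.subset_adjoin (Set.mem_singleton_iff.mpr rfl)⟩ = q →
        ((∃ w : Polynomial k →ₗ[k] Polynomial k,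
            (fun a b => a 0 * a 1 * (v (b 0 1) - v' (b 0 1)))
              = δ (Algebra.adjoin k {f}).val 1 (fun a _ => w (a 0)))
          ↔ Polynomial.derivative f ∣ (p - q)))
    -- the dimension count for `f = Xⁿ`
    ∧ (∀ n : ℕ, 2 ≤ n → ¬ ((ringChar k : ℕ) ∣ n) → f = Polynomial.X ^ n →
        Module.finrank k
          (Polynomial k ⧸ Ideal.span {Polynomial.derivative f}) = n - 1) := by
  refine ⟨?_, ?_, ?_, ?_⟩
  · intro q
    obtain ⟨v, h1, h2⟩ := exists_der f hf q
    refine ⟨v, h1, h2, ?_⟩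
    funext a b
    rw [delta_two (fun x y z => x * y * v z)]
    simp only [h1, Pi.zero_apply]
    ring
  · intro σ hσ
    have H := cocycle_coord (fun x y z => σ x y z) hσ
    obtain ⟨w, hw⟩ := hochschild_vanish
      (LinearMap.mk₂ k (fun a b => σ a b 1) (by simp) (by simp) (by simp) (by simp))
      (by
        intro a b c
        have := H a b c 1 1 1
        simpa using this)
    simp only [LinearMap.mk₂_apply] at hw
    -- the normalised cocycle
    let τ : Polynomial k → Polynomial k → ↥(Algebra.adjoin k {f}) → Polynomial k :=
      fun a b x => σ a b x - (a * x * w b - w (x * a * b) + w a * (b * x))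
    have T : ∀ a0 a1 a2 (x y z : ↥(Algebra.adjoin k {f})),
        a0 * ((x : Polynomial k) * y) * τ a1 a2 z
        - τ (x * a0 * a1) a2 (y * z)
        + τ a0 (z * a1 * a2) (x * y)
        - τ a0 a1 x * (a2 * ((y : Polynomial k) * z)) = 0 := by
      intro a0 a1 a2 x y z
      have h := H a0 a1 a2 x y z
      simp only [τ, MulMemClass.coe_mul]
      have e1 : (x : Polynomial k) * y * a0 * (z * a1 * a2)
        = y * z * (x * a0 * a1) * a2 := by ring
      rw [e1]
      linear_combination h
    have T1 : ∀ a b, τ a b 1 = 0 := by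
      intro a b
      simp only [τ, OneMemClass.coe_one, mul_one, one_mul]
      rw [hw]; ring
    have T2 : ∀ a b x, τ a b x = τ 1 (a * b) x := by
      intro a b x
      have := T 1 a b 1 x 1
      simp only [T1, OneMemClass.coe_one, mul_one, one_mul] at this
      linear_combination -this
    have T3 : ∀ a x, τ 1 a x = a * τ 1 1 x := by
      intro a x
      have := T 1 1 a x 1 1
      simp only [T1, OneMemClass.coe_one, mul_one, one_mul] at this
      linear_combination this
    have T4 : ∀ a b x, τ a b x = a * b * τ 1 1 x := fun a b x => by rw [T2, T3]
    let v : ↥(Algebra.adjoin k {f}) →ₗ[k] Polynomial k :=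
      σ 1 1 - ((LinearMap.mulRight k (w 1)) ∘ₗ (Algebra.adjoin k {f}).val.toLinearMap
        - w ∘ₗ (Algebra.adjoin k {f}).val.toLinearMap
        + (LinearMap.mulLeft k (w 1)) ∘ₗ (Algebra.adjoin k {f}).val.toLinearMap)
    have hv : ∀ x, v x = τ 1 1 x := by
      intro x
      simp [v, τ]
    refine ⟨_, v, ?_, rfl, w, ?_⟩
    · intro x y
      have := T 1 1 1 x y 1
      simp only [T1, OneMemClass.coe_one, mul_one, one_mul] at this
      rw [T4 x 1 y] at this
      rw [hv, hv, hv]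
      linear_combination this
    · funext a b
      rw [delta_one w, hv, ← T4]
      simp only [τ]
      ring
  · intro p q v v' hv hv' hp hq
    constructor
    · rintro ⟨w, hw⟩
      have hw' : ∀ a b (x : ↥(Algebra.adjoin k {f})), a * b * (v x - v' x)
          = a * x * w b - w (x * a * b) + w a * (b * x) := by
        intro a b x
        have := congrFun (congrFun hw (fun i => if i = 0 then a else b)) (fun _ _ => x)
        rw [delta_one w] at this
        simpa using this
      have hv1 : v 1 = 0 := by
        have := hv 1 1
        simp only [one_mul, OneMemClass.coe_one] at this
        linear_combination -this
      have hv1' : v' 1 = 0 := by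
        have := hv' 1 1
        simp only [one_mul, OneMemClass.coe_one] at this
        linear_combination -this
      have hder : ∀ a b, w (a * b) = a * w b + w a * b := by
        intro a b
        have := hw' a b 1
        simp only [hv1, hv1', one_mul, mul_one, OneMemClass.coe_one] at this
        linear_combination this
      have h1 : w 1 = 0 := by
        rw [der_eq w hder]; simp
      have := hw' 1 1 ⟨f, Algebra.subset_adjoin (Set.mem_singleton_iff.mpr rfl)⟩
      rw [hp, hq] at this
      simp only [h1, one_mul, mul_one] at this
      rw [der_eq w hder f] at this
      exact ⟨- w Polynomial.X, by linear_combination this⟩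
    · rintro ⟨h, hh⟩
      have hu : ∀ x : ↥(Algebra.adjoin k {f}),
          v x - v' x = Polynomial.derivative (x : Polynomial k) * h := by
        have hz : ∀ u : ↥(Algebra.adjoin k {f}) →ₗ[k] Polynomial k,
            (∀ x y : ↥(Algebra.adjoin k {f}),
              u (x * y) = (x : Polynomial k) * u y + (y : Polynomial k) * u x) → u 1 = 0 := by
          intro u hu
          have := hu 1 1
          simp only [one_mul, OneMemClass.coe_one] at this
          linear_combination -this
        rintro ⟨x, hx⟩
        induction hx using Algebra.adjoin_induction with
        | mem x hx =>
          obtain rfl := Set.mem_singleton_iff.mp hx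
          rw [hp, hq, hh]
        | algebraMap r =>
          have : (⟨algebraMap k (Polynomial k) r, Subalgebra.algebraMap_mem _ r⟩ :
              ↥(Algebra.adjoin k {f})) = r • 1 := by
            apply Subtype.ext
            exact Algebra.algebraMap_eq_smul_one r
          rw [this, map_smul, map_smul, hz v hv, hz v' hv']
          simp
        | add x y hx hy ihx ihy =>
          have e : (⟨x + y, add_mem hx hy⟩ : ↥(Algebra.adjoin k {f})) = ⟨x, hx⟩ + ⟨y, hy⟩ := rfl
          rw [e, map_add, map_add]
          simp only [AddMemClass.coe_add, map_add] at ihx ihy ⊢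
          linear_combination ihx + ihy
        | mul x y hx hy ihx ihy =>
          have e : (⟨x * y, mul_mem hx hy⟩ : ↥(Algebra.adjoin k {f})) = ⟨x, hx⟩ * ⟨y, hy⟩ := rfl
          rw [e, hv, hv']
          simp only [MulMemClass.coe_mul, Polynomial.derivative_mul] at ihx ihy ⊢
          linear_combination y * ihx + x * ihy
      let w : Polynomial k →ₗ[k] Polynomial k :=
        -((LinearMap.mulRight k h) ∘ₗ Polynomial.derivative)
      have hwd : ∀ g, w g = - (Polynomial.derivative g * h) := fun g => by simp [w]
      refine ⟨w, ?_⟩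
      funext a b
      rw [delta_one w]
      simp only [hwd, hu, Polynomial.derivative_mul]
      ring
  · rintro n hn hc rfl
    have hn0 : (n : k) ≠ 0 := fun h => hc ((ringChar.spec k n).mp h)
    rw [finrank_quotient_span_eq_natDegree, Polynomial.derivative_X_pow,
      Polynomial.natDegree_C_mul_X_pow _ _ hn0]

end SecondaryHochschild
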